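/- Let S be an S-tree. Then for every maximum matching M of S and every edge e ∈ M, the edge e contains exactly one vertex of Core(S); that is, |e ∩ Core(S)| = 1. -/

import Mathlib

open scoped Classical

namespace NullDecomp

variable {V : Type*}

/-- The null space of the real adjacency matrix of a graph. -/
def nullSpace [Fintype V] (G : SimpleGraph V) : Set (V → ℝ) :=
  {x | Matrix.mulVec (G.adjMatrix ℝ) x = 0}

/-- The support of the null space: vertices with a nonzero entry in some null vector. -/
def supportSet [Fintype V] (G : SimpleGraph V) : Set V :=
  {v | ∃ x ∈ nullSpace G, x v ≠ 0}

/-- The (open) neighborhood of a set of vertices. -/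
def nbhdSet (G : SimpleGraph V) (A : Set V) : Set V :=
  {v | ∃ u ∈ A, G.Adj u v}

/-- The closed neighborhood of a set of vertices. -/
def closedNbhd (G : SimpleGraph V) (A : Set V) : Set V :=
  A ∪ nbhdSet G A

/-- The core of a graph: the neighborhood of the support of the null space. -/
def coreSet [Fintype V] (G : SimpleGraph V) : Set V :=
  nbhdSet G (supportSet G)

/-- A tree is an S-tree if the closed neighborhood of its support is everything. -/
def IsSTree [Fintype V] (G : SimpleGraph V) : Prop :=
  G.IsTree ∧ closedNbhd G (supportSet G) = Set.univ

/-- A matching: a set of edges of `G`, pairwise disjoint. -/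
def IsMatchingSet (G : SimpleGraph V) (M : Finset (Sym2 V)) : Prop :=
  (↑M : Set (Sym2 V)) ⊆ G.edgeSet ∧
    ∀ e ∈ M, ∀ f ∈ M, e ≠ f → ∀ v : V, v ∈ e → v ∉ f

/-- A maximum matching. -/
def IsMaxMatching [Fintype V] (G : SimpleGraph V) (M : Finset (Sym2 V)) : Prop :=
  IsMatchingSet G M ∧ ∀ M' : Finset (Sym2 V), IsMatchingSet G M' → M'.card ≤ M.card

/-- The matching number. -/
noncomputable def matchingNumber [Fintype V] (G : SimpleGraph V) : ℕ :=
  sSup {n | ∃ M : Finset (Sym2 V), IsMatchingSet G M ∧ M.card = n}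

/-- An independent set of vertices. -/
def IsIndep (G : SimpleGraph V) (A : Set V) : Prop :=
  ∀ u ∈ A, ∀ w ∈ A, ¬ G.Adj u w

/-- The independence number. -/
noncomputable def indepNumber [Fintype V] (G : SimpleGraph V) : ℕ :=
  sSup {n | ∃ A : Set V, IsIndep G A ∧ A.ncard = n}

/-- A vertex cover. -/
def IsVertexCover (G : SimpleGraph V) (Cs : Set V) : Prop :=
  ∀ e ∈ G.edgeSet, ∃ v ∈ Cs, v ∈ e

/-- The vertex cover number. -/
noncomputable def coverNumber [Fintype V] (G : SimpleGraph V) : ℕ :=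
  sInf {n | ∃ Cs : Set V, IsVertexCover G Cs ∧ Cs.ncard = n}

/-- The nullity of a graph: dimension of the kernel of its adjacency matrix. -/
noncomputable def nullity [Fintype V] (G : SimpleGraph V) : ℕ :=
  Module.finrank ℝ (LinearMap.ker (Matrix.mulVecLin (G.adjMatrix ℝ)))

/-- The number of maximum matchings of a graph. -/
noncomputable def numMaxMatchings [Fintype V] (G : SimpleGraph V) : ℕ :=
  Set.ncard {M : Finset (Sym2 V) | IsMaxMatching G M}

/-- `C` is (the vertex set of) a connected component of the subgraph of `T`
induced by the closed neighborhood of the support of `T`. -/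
def IsSComponent [Fintype V] (T : SimpleGraph V) (C : Set V) : Prop :=
  ∃ c : (T.induce (closedNbhd T (supportSet T))).ConnectedComponent,
    C = Subtype.val '' c.supp

/-- `C` is (the vertex set of) a connected component of the subgraph of `T`
induced by the complement of the closed neighborhood of the support of `T`. -/
def IsNComponent [Fintype V] (T : SimpleGraph V) (C : Set V) : Prop :=
  ∃ c : (T.induce ((closedNbhd T (supportSet T))ᶜ)).ConnectedComponent,
    C = Subtype.val '' c.supp

/-- The zero-extension to `ℝ^V` of the null space of the subgraph of `T` induced by `C`:
vectors vanishing outside `C` whose restriction to `C` is a null vector of `T.induce C`. -/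
noncomputable def extNull [Fintype V] (T : SimpleGraph V) (C : Set V) : Submodule ℝ (V → ℝ) :=
  LinearMap.ker ((Matrix.mulVecLin ((T.induce C).adjMatrix ℝ)).comp
      (LinearMap.funLeft ℝ ℝ (Subtype.val : ↥C → V))) ⊓
  LinearMap.ker (LinearMap.funLeft ℝ ℝ (Subtype.val : ↥(Cᶜ) → V))

lemma mem_nullSpace_iff [Fintype V] {G : SimpleGraph V} {x : V → ℝ} :
    x ∈ nullSpace G ↔ ∀ p, ∑ q, (if G.Adj p q then x q else 0) = 0 := by
  simp [nullSpace, funext_iff, Matrix.mulVec, dotProduct, SimpleGraph.adjMatrix_apply]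

/-- The adjacency operator of a graph is symmetric, so its image is orthogonal to its kernel. -/
lemma sum_mul_adj_sum_eq_zero [Fintype V] {G : SimpleGraph V} {y : V → ℝ}
    (hy : y ∈ nullSpace G) (w : V → ℝ) :
    ∑ p, y p * ∑ q, (if G.Adj p q then w q else 0) = 0 := by
  simp_rw [Finset.mul_sum]
  rw [Finset.sum_comm]
  refine Finset.sum_eq_zero fun q _ => ?_
  have h := mem_nullSpace_iff.1 hy q
  calc ∑ p, y p * (if G.Adj p q then w q else 0)
      = w q * ∑ p, (if G.Adj q p then y p else 0) := by
        rw [Finset.mul_sum]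
        refine Finset.sum_congr rfl fun p _ => ?_
        simp only [G.adj_comm p q]
        split_ifs <;> ring
    _ = 0 := by rw [h, mul_zero]

/-- The support of the null space of an acyclic graph is independent. -/
lemma isIndep_supportSet [Fintype V] {G : SimpleGraph V} (hG : G.IsAcyclic) :
    IsIndep G (supportSet G) := by
  rintro u ⟨x, hx, hxu⟩ v ⟨y, hy, hyv⟩ huv
  have hbr : ¬ (G.deleteEdges {s(u, v)}).Reachable u v :=
    SimpleGraph.isAcyclic_iff_forall_adj_isBridge.1 hG huv
  let c := hG.coloringTwo
  have hc : ∀ {p q : V}, G.Adj p q → c p ≠ c q := fun h => c.valid h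
  let R : V → Prop := fun p => (G.deleteEdges {s(u, v)}).Reachable u p
  have hRu : R u := SimpleGraph.Reachable.refl u
  have hR : ∀ {p q : V}, G.Adj p q → s(p, q) ≠ s(u, v) → (R p ↔ R q) := by
    intro p q hpq hne
    have hadj : (G.deleteEdges {s(u, v)}).Adj p q := by
      simpa [SimpleGraph.deleteEdges_adj, hpq] using hne
    exact ⟨fun h => h.trans hadj.reachable, fun h => h.trans hadj.symm.reachable⟩
  -- The part of `x` in the colour class of `u`, on the side of `u` of the edge `uv`.
  let w : V → ℝ := fun p => if R p ∧ c p = c u then x p else 0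
  have hw : ∀ p, ∑ q, (if G.Adj p q then w q else 0) = if p = v then x u else 0 := by
    intro p
    by_cases hpv : p = v
    · subst hpv
      rw [if_pos rfl, Finset.sum_eq_single u]
      · simp [huv.symm, w, hRu]
      · intro q _ hqu
        by_cases hq : G.Adj p q
        · have : ¬ R q := fun h => hbr ((hR hq (by simp [hqu, huv.ne'])).2 h)
          simp [w, this]
        · simp [hq]
      · simp
    · rw [if_neg hpv]
      by_cases hcp : c p = c u
      · refine Finset.sum_eq_zero fun q _ => ?_
        by_cases hq : G.Adj p q
        · have : c q ≠ c u := fun h => hc hq (hcp.trans h.symm)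
          simp [w, this]
        · simp [hq]
      · have hpu : p ≠ u := fun h => hcp (h ▸ rfl)
        have key : ∀ q, (if G.Adj p q then w q else 0)
            = if R p then (if G.Adj p q then x q else 0) else 0 := by
          intro q
          by_cases hq : G.Adj p q
          · have h1 : c q = c u := by
              have := hc hq
              omega
            have h2 := hR hq (by simp [hpu, hpv])
            simp [w, h1, h2, hq]
          · simp [hq]
        simp_rw [key]
        by_cases hRp : R p
        · simpa [hRp] using mem_nullSpace_iff.1 hx p
        · simp [hRp]
  have h := sum_mul_adj_sum_eq_zero hy w
  simp_rw [hw] at h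
  simp [hxu, hyv] at h

/-- A tree can be rooted: it has a parent function. -/
lemma exists_parent {G : SimpleGraph V} (hG : G.IsTree) :
    ∃ parent : V → V, ∀ u v, G.Adj u v → parent u = v ∨ parent v = u := by
  obtain ⟨r⟩ := hG.connected.nonempty
  choose f hf _ using hG.existsUnique_path r
  refine ⟨fun w => (f w).penultimate, fun u v huv => ?_⟩
  by_cases hv : v ∈ (f u).support
  · exact .inl (hG.isAcyclic.eq_penultimate_of_adj_end (hf u) huv hv).symm
  · exact .inr (hG.isAcyclic.eq_penultimate_of_adj_end (hf v) huv.symm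
      (hG.isAcyclic.mem_support_of_ne_mem_support_of_adj_of_isPath (hf v) (hf u) huv.symm hv)).symm

/-- A core vertex has at least two neighbors in the support. -/
lemma exists_ne_adj_of_mem_coreSet [Fintype V] {G : SimpleGraph V} {v : V}
    (hv : v ∈ coreSet G) :
    ∃ a ∈ supportSet G, ∃ b ∈ supportSet G, a ≠ b ∧ G.Adj v a ∧ G.Adj v b := by
  obtain ⟨a, ⟨x, hx, hxa⟩, hav⟩ := hv
  by_contra! hcon
  refine hxa ?_
  rw [← mem_nullSpace_iff.1 hx v, Finset.sum_eq_single a]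
  · simp [hav.symm]
  · intro b _ hba
    by_contra hb
    obtain ⟨hvb, hxb⟩ : G.Adj v b ∧ x b ≠ 0 := by simpa using hb
    exact hcon a ⟨x, hx, hxa⟩ b ⟨x, hx, hxb⟩ hba.symm hav.symm hvb
  · simp

/-- In a tree, the core can be matched into the support. -/
lemma exists_injOn_coreSet [Fintype V] {G : SimpleGraph V} (hG : G.IsTree) :
    ∃ f : V → V, Set.InjOn f (coreSet G) ∧
      ∀ v ∈ coreSet G, f v ∈ supportSet G ∧ G.Adj v (f v) := by
  obtain ⟨parent, hp⟩ := exists_parent hG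
  have h : ∀ v, ∃ a, v ∈ coreSet G → a ∈ supportSet G ∧ G.Adj v a ∧ parent a = v := by
    intro v
    by_cases hv : v ∈ coreSet G
    · obtain ⟨a, ha, b, hb, hab, hva, hvb⟩ := exists_ne_adj_of_mem_coreSet hv
      rcases hp v a hva with h | h
      · rcases hp v b hvb with h' | h'
        · exact absurd (h.symm.trans h') hab
        · exact ⟨b, fun _ => ⟨hb, hvb, h'⟩⟩
      · exact ⟨a, fun _ => ⟨ha, hva, h⟩⟩
    · exact ⟨v, fun h => absurd h hv⟩
  choose f hf using h
  refine ⟨f, fun v hv w hw hvw => ?_, fun v hv => ⟨(hf v hv).1, (hf v hv).2.1⟩⟩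
  rw [← (hf v hv).2.2, hvw, (hf w hw).2.2]

lemma disjoint_supportSet_coreSet [Fintype V] {G : SimpleGraph V} (hG : G.IsAcyclic) :
    Disjoint (supportSet G) (coreSet G) :=
  Set.disjoint_left.2 fun v hv ⟨u, hu, huv⟩ => isIndep_supportSet hG u hu v hv huv

/-- In a tree, a maximum matching has at least as many edges as there are core vertices. -/
lemma IsMaxMatching.card_core_le [Fintype V] {G : SimpleGraph V} (hG : G.IsTree)
    {M : Finset (Sym2 V)} (hM : IsMaxMatching G M) :
    (Finset.univ.filter (· ∈ coreSet G)).card ≤ M.card := by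
  obtain ⟨f, hinj, hf⟩ := exists_injOn_coreSet hG
  have hdisj := Set.disjoint_left.1 (disjoint_supportSet_coreSet hG.isAcyclic)
  have heq : ∀ v ∈ coreSet G, ∀ w ∈ coreSet G, ∀ z, z ∈ s(v, f v) → z ∈ s(w, f w) → v = w := by
    intro v hv w hw z hz hz'
    rcases Sym2.mem_iff.1 hz with rfl | rfl <;> rcases Sym2.mem_iff.1 hz' with h | h
    · exact h
    · exact absurd (h ▸ hv) (hdisj (hf w hw).1)
    · exact absurd (h ▸ hw) (hdisj (hf v hv).1)
    · exact hinj hv hw h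
  have hcard : ((Finset.univ.filter (· ∈ coreSet G)).image fun v => s(v, f v)).card
      = (Finset.univ.filter (· ∈ coreSet G)).card := by
    refine Finset.card_image_of_injOn fun v hv w hw hvw => ?_
    have hvw' : s(v, f v) = s(w, f w) := hvw
    exact heq v (by simpa using hv) w (by simpa using hw) v (Sym2.mem_mk_left _ _)
      (hvw' ▸ Sym2.mem_mk_left _ _)
  rw [← hcard]
  refine hM.2 _ ⟨?_, ?_⟩
  · intro e he
    obtain ⟨v, hv, rfl⟩ : ∃ v ∈ coreSet G, s(v, f v) = e := by simpa using he
    exact (hf v hv).2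
  · intro e he e' he' hne z hz hz'
    obtain ⟨v, hv, rfl⟩ : ∃ v ∈ coreSet G, s(v, f v) = e := by simpa using he
    obtain ⟨w, hw, rfl⟩ : ∃ v ∈ coreSet G, s(v, f v) = e' := by simpa using he'
    exact hne (by rw [heq v hv w hw z hz hz'])

/-- In an S-tree, every edge has an end in the core. -/
lemma IsSTree.exists_mem_coreSet [Fintype V] {S : SimpleGraph V} (hS : IsSTree S)
    {e : Sym2 V} (he : e ∈ S.edgeSet) : ∃ v, v ∈ e ∧ v ∈ coreSet S := by
  induction e with
  | h u v =>
    have hu : u ∈ supportSet S ∪ coreSet S := hS.2.ge (Set.mem_univ u)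
    rcases hu with hu | hu
    · exact ⟨v, Sym2.mem_mk_right _ _, u, hu, he⟩
    · exact ⟨u, Sym2.mem_mk_left _ _, hu⟩

/-- In an S-tree, every edge of every maximum matching contains exactly one core vertex. -/
theorem stmt6 [Fintype V] (S : SimpleGraph V) (hS : IsSTree S)
    (M : Finset (Sym2 V)) (hM : IsMaxMatching S M) :
    ∀ e ∈ M, ∃! v : V, v ∈ e ∧ v ∈ coreSet S := by
  have hex : ∀ e, ∃ v, e ∈ M → v ∈ e ∧ v ∈ coreSet S := by
    intro e
    by_cases he : e ∈ M
    · obtain ⟨v, hv⟩ := hS.exists_mem_coreSet (hM.1.1 he)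
      exact ⟨v, fun _ => hv⟩
    · exact ⟨e.out.1, fun h => absurd h he⟩
  choose g hg using hex
  have hmeet : ∀ e ∈ M, ∀ e' ∈ M, ∀ v, v ∈ e → v ∈ e' → e = e' :=
    fun e he e' he' v hv hv' => by_contra fun hne => hM.1.2 e he e' he' hne v hv hv'
  have hinj : Set.InjOn g M := fun e he e' he' h =>
    hmeet e he e' he' (g e) (hg e he).1 (h ▸ (hg e' he').1)
  have himage : M.image g = Finset.univ.filter (· ∈ coreSet S) := by
    refine Finset.eq_of_subset_of_card_le ?_ ?_
    · intro v hv
      obtain ⟨e, he, rfl⟩ := Finset.mem_image.1 hv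
      simpa using (hg e he).2
    · rw [Finset.card_image_of_injOn hinj]
      exact hM.card_core_le hS.1
  intro e he
  refine ⟨g e, hg e he, fun v ⟨hve, hv⟩ => ?_⟩
  obtain ⟨e', he', rfl⟩ := Finset.mem_image.1 (himage ▸ by simpa using hv : v ∈ M.image g)
  rw [hmeet e he e' he' _ hve (hg e' he').1]

end NullDecomp
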